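/- Let G be a finite abelian group of the form C_{n₁} ⊕ ⋯ ⊕ C_{n_r} with 1 < n₁ ∣ n₂ ∣ ⋯ ∣ n_r, and let A ⊆ G be a generating set. Then for every g ∈ G, the positive length ℓ⁺_A(g) is at most D*(G) − 1 = Σ_{i=1}^{r}(n_i − 1), i.e., every element of G can be written as a sum of at most Σ(n_i − 1) elements of A. -/

import Mathlib

/-- If an elementary abelian `p`-group is generated by `e i` for `i ∈ S`, then every element is a
sum of at most `#S * (p - 1)` elements of any generating set `A`. -/
theorem exists_multiset_sum_eq_of_prime_nsmul_eq_zero {V ι : Type*} [AddCommGroup V]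
    (p : ℕ) [Fact p.Prime] (hV : ∀ x : V, p • x = 0) (S : Finset ι) (e : ι → V)
    (he : AddSubgroup.closure (e '' S) = ⊤) (A : Set V)
    (hA : AddSubgroup.closure A = ⊤) (g : V) :
    ∃ s : Multiset V, (∀ x ∈ s, x ∈ A) ∧ s.card ≤ S.card * (p - 1) ∧ s.sum = g := by
  classical
  have : Module (ZMod p) V := AddCommGroup.zmodModule hV
  have span_eq_top {B : Set V} (hB : AddSubgroup.closure B = ⊤) :
      Submodule.span (ZMod p) B = ⊤ := by
    rw [eq_top_iff]
    intro x _
    have hx : x ∈ AddSubgroup.closure B := hB ▸ AddSubgroup.mem_top x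
    exact (AddSubgroup.closure_le (Submodule.span (ZMod p) B).toAddSubgroup).2
      Submodule.subset_span hx
  have hSspan : Submodule.span (ZMod p) ((S.image e : Finset V) : Set V) = ⊤ := by
    rw [← span_eq_top he, Finset.coe_image]
  have hfin : Module.Finite (ZMod p) V := ⟨⟨_, hSspan⟩⟩
  have hrank : Module.finrank (ZMod p) V ≤ S.card := by
    rw [← finrank_top, ← hSspan]
    exact (finrank_span_finset_le_card _).trans Finset.card_image_le
  obtain ⟨b, hbA, hbspan, hb⟩ := exists_linearIndependent (ZMod p) A
  rw [span_eq_top hA] at hbspan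
  have hbfin : b.Finite := hb.setFinite
  lift b to Finset V using hbfin
  have hbcard : b.card ≤ S.card := by
    have := hb.fintype_card_le_finrank
    simp only [Finset.coe_sort_coe, Fintype.card_coe] at this
    exact this.trans hrank
  have hg : g ∈ Submodule.span (ZMod p) (b : Set V) := hbspan ▸ Submodule.mem_top
  obtain ⟨c, -, hc⟩ := Submodule.mem_span_finset.1 hg
  refine ⟨∑ x ∈ b, Multiset.replicate (c x).val x, ?_, ?_, ?_⟩
  · intro y hy
    obtain ⟨x, hx, hy⟩ := Multiset.mem_sum.1 hy
    rw [Multiset.eq_of_mem_replicate hy]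
    exact hbA hx
  · rw [Multiset.card_sum]
    simp only [Multiset.card_replicate]
    calc ∑ x ∈ b, (c x).val ≤ ∑ _x ∈ b, (p - 1) :=
          Finset.sum_le_sum fun x _ => Nat.le_sub_one_of_lt (ZMod.val_lt (c x))
      _ = b.card * (p - 1) := by simp
      _ ≤ S.card * (p - 1) := Nat.mul_le_mul_right _ hbcard
  · rw [← hc, Multiset.sum_sum]
    refine Finset.sum_congr rfl fun x _ => ?_
    rw [Multiset.sum_replicate, ← Nat.cast_smul_eq_nsmul (ZMod p), ZMod.natCast_zmod_val]

/-- A multiset of elements of `f '' A` lifts along `f` to a multiset of elements of `A`. -/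
theorem Multiset.exists_map_eq_of_forall_mem_image {α β : Type*} {f : α → β} {A : Set α}
    {t : Multiset β} (ht : ∀ y ∈ t, y ∈ f '' A) :
    ∃ s : Multiset α, (∀ x ∈ s, x ∈ A) ∧ s.map f = t := by
  induction t using Multiset.induction with
  | empty => exact ⟨0, by simp, rfl⟩
  | cons y t ih =>
    rw [Multiset.forall_mem_cons] at ht
    obtain ⟨⟨x, hx, rfl⟩, ht⟩ := ht
    obtain ⟨s, hs, rfl⟩ := ih ht
    exact ⟨x ::ₘ s, Multiset.forall_mem_cons.2 ⟨hx, hs⟩, Multiset.map_cons f x s⟩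

/-- A surjective homomorphism maps generating sets to generating sets. -/
theorem AddSubgroup.closure_image_eq_top {G H : Type*} [AddGroup G] [AddGroup H] {f : G →+ H}
    (hf : Function.Surjective f) {B : Set G} (hB : AddSubgroup.closure B = ⊤) :
    AddSubgroup.closure (f '' B) = ⊤ := by
  rw [← AddMonoidHom.map_closure, hB, ← AddMonoidHom.range_eq_map, AddMonoidHom.range_eq_top.2 hf]

/-- If `G` is generated by `e i` for `i ∈ S`, then modulo `p • G` every element is a
sum of at most `#S * (p - 1)` elements of any generating set `A`. -/
theorem exists_multiset_sub_sum_mem_range_nsmul {G ι : Type*} [AddCommGroup G]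
    (p : ℕ) [Fact p.Prime] (S : Finset ι) (e : ι → G)
    (he : AddSubgroup.closure (e '' S) = ⊤) (A : Set G)
    (hA : AddSubgroup.closure A = ⊤) (g : G) :
    ∃ s : Multiset G, (∀ x ∈ s, x ∈ A) ∧ s.card ≤ S.card * (p - 1) ∧
      g - s.sum ∈ (nsmulAddMonoidHom (α := G) p).range := by
  set H := (nsmulAddMonoidHom (α := G) p).range
  let π : G →+ G ⧸ H := QuotientAddGroup.mk' H
  have hπ : Function.Surjective π := QuotientAddGroup.mk'_surjective H
  have hker (x : G) : π x = 0 ↔ x ∈ H := QuotientAddGroup.eq_zero_iff x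
  have htorsion (x : G ⧸ H) : p • x = 0 := by
    obtain ⟨y, rfl⟩ := hπ x
    rw [← map_nsmul, hker]
    exact ⟨y, rfl⟩
  obtain ⟨t, htA, htcard, ht⟩ := exists_multiset_sum_eq_of_prime_nsmul_eq_zero p htorsion S
    (fun i => π (e i)) (by simpa [Set.image_image] using AddSubgroup.closure_image_eq_top hπ he)
    (π '' A) (AddSubgroup.closure_image_eq_top hπ hA) (π g)
  obtain ⟨s, hsA, rfl⟩ := Multiset.exists_map_eq_of_forall_mem_image htA
  refine ⟨s, hsA, by simpa using htcard, ?_⟩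
  rw [← hker, map_sub, map_multiset_sum, ht, sub_self]

/-- If an abelian group is generated by elements `e i` with `n i • e i = 0`, where the `n i` form
a divisibility chain, then every element is a sum of at most `∑ i, (n i - 1)` elements of any
generating set. -/
theorem exists_multiset_sum_eq_of_nsmul_eq_zero {ι G : Type*} [Fintype ι] [LinearOrder ι]
    [AddCommGroup G] (n : ι → ℕ) (hpos : ∀ i, 0 < n i) (hdvd : ∀ i j, i ≤ j → n i ∣ n j)
    (e : ι → G) (hne : ∀ i, n i • e i = 0) (he : AddSubgroup.closure (Set.range e) = ⊤)
    (A : Set G) (hA : AddSubgroup.closure A = ⊤) (g : G) :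
    ∃ s : Multiset G, (∀ x ∈ s, x ∈ A) ∧ s.card ≤ ∑ i, (n i - 1) ∧ s.sum = g := by
  induction hN : ∑ i, n i using Nat.strong_induction_on generalizing n G with
  | _ N ih =>
  let S : Finset ι := {i | n i ≠ 1}
  have hS (i : ι) : i ∈ S ↔ n i ≠ 1 := by simp [S]
  have heS (i : ι) (hi : i ∉ S) : e i = 0 := by
    rw [hS, not_not] at hi
    simpa [hi] using hne i
  have heS_top : AddSubgroup.closure (e '' S) = ⊤ := by
    rw [eq_top_iff, ← he, AddSubgroup.closure_le]
    rintro _ ⟨i, rfl⟩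
    by_cases hi : i ∈ S
    · exact AddSubgroup.subset_closure ⟨i, hi, rfl⟩
    · rw [heS i hi]
      exact zero_mem _
  rcases S.eq_empty_or_nonempty with hSe | hSne
  · refine ⟨0, by simp, by simp, ?_⟩
    have hg : g ∈ AddSubgroup.closure (e '' S) := heS_top ▸ AddSubgroup.mem_top g
    simpa [hSe, eq_comm] using hg
  obtain ⟨p, hp, hpdvd⟩ := Nat.exists_prime_and_dvd ((hS _).1 (S.min'_mem hSne))
  have hpS (i : ι) (hi : i ∈ S) : p ∣ n i := hpdvd.trans (hdvd _ _ (S.min'_le i hi))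
  have : Fact p.Prime := ⟨hp⟩
  obtain ⟨s, hsA, hscard, hs⟩ :=
    exists_multiset_sub_sum_mem_range_nsmul p S e heS_top A hA g
  let φ := (nsmulAddMonoidHom (α := G) p).rangeRestrict
  have hφ : Function.Surjective φ := AddMonoidHom.rangeRestrict_surjective _
  let m : ι → ℕ := fun i => if i ∈ S then n i / p else 1
  have hm_mem (i : ι) (hi : i ∈ S) : n i = p * m i := by
    simp only [m, if_pos hi, Nat.mul_div_cancel' (hpS i hi)]
  have hm_notMem (i : ι) (hi : i ∉ S) : n i = 1 ∧ m i = 1 :=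
    ⟨by simpa [hS] using hi, if_neg hi⟩
  have hmpos (i : ι) : 0 < m i := by
    by_cases hi : i ∈ S
    · exact Nat.pos_of_mul_pos_left (hm_mem i hi ▸ hpos i)
    · simp [hm_notMem i hi]
  have hmdvd (i j : ι) (hij : i ≤ j) : m i ∣ m j := by
    by_cases hi : i ∈ S
    · have hj : j ∈ S := by
        rw [hS] at hi ⊢
        exact fun hj => hi (Nat.dvd_one.1 (hj ▸ hdvd i j hij))
      have := hdvd i j hij
      rw [hm_mem i hi, hm_mem j hj] at this
      exact Nat.dvd_of_mul_dvd_mul_left hp.pos this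
    · simp [hm_notMem i hi]
  have hme (i : ι) : m i • φ (e i) = 0 := by
    by_cases hi : i ∈ S
    · rw [← map_nsmul]
      ext
      change p • m i • e i = 0
      rw [← mul_nsmul', ← hm_mem i hi, hne]
    · simp [heS i hi]
  have hlt : ∑ i, m i < N := by
    rw [← hN]
    obtain ⟨j, hj⟩ := hSne
    refine Finset.sum_lt_sum (fun i _ => ?_) ⟨j, Finset.mem_univ j, ?_⟩
    · by_cases hi : i ∈ S
      · rw [hm_mem i hi]
        exact Nat.le_mul_of_pos_left _ hp.pos
      · simp [hm_notMem i hi]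
    · rw [hm_mem j hj]
      exact lt_mul_of_one_lt_left (hmpos j) hp.one_lt
  obtain ⟨t, htA, htcard, ht⟩ := ih _ hlt m hmpos hmdvd (fun i => φ (e i)) hme
    (by simpa [← Set.range_comp, Function.comp_def] using AddSubgroup.closure_image_eq_top hφ he) (φ '' A)
    (AddSubgroup.closure_image_eq_top hφ hA) ⟨_, hs⟩ rfl
  obtain ⟨u, huA, rfl⟩ := Multiset.exists_map_eq_of_forall_mem_image htA
  refine ⟨s + p • u, ?_, ?_, ?_⟩
  · intro x hx
    rcases Multiset.mem_add.1 hx with hx | hx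
    · exact hsA x hx
    · exact huA x (Multiset.mem_of_mem_nsmul hx)
  · rw [Multiset.card_map] at htcard
    rw [Multiset.card_add, Multiset.card_nsmul]
    calc s.card + p * u.card
        ≤ S.card * (p - 1) + p * ∑ i, (m i - 1) := by gcongr
      _ = ∑ i, ((if i ∈ S then p - 1 else 0) + p * (m i - 1)) := by
          rw [Finset.sum_add_distrib, Finset.mul_sum, ← Finset.sum_filter]
          simp
      _ = ∑ i, (n i - 1) := by
          refine Finset.sum_congr rfl fun i _ => ?_
          by_cases hi : i ∈ S
          · rw [if_pos hi, hm_mem i hi]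
            obtain ⟨k, hk⟩ := Nat.exists_eq_add_of_lt (hmpos i)
            have := hp.pos
            simp only [hk, zero_add, Nat.add_sub_cancel, mul_add, mul_one]
            omega
          · simp [hi, hm_notMem i hi]
  · rw [← map_multiset_sum] at ht
    have hsum : p • u.sum = g - s.sum := congrArg Subtype.val ht
    rw [Multiset.sum_add, Multiset.sum_nsmul, hsum, add_sub_cancel]

/-- Klopsch–Lev positive diameter bound: in `G ≅ C_{n₁} ⊕ ⋯ ⊕ C_{n_r}` with
`1 < n₁ ∣ ⋯ ∣ n_r`, every element is a sum of at most `Σ (n_i − 1)` elements of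
any generating set `A`. -/
theorem positive_length_le_Dstar_sub_one
    (r : ℕ) (n : Fin r → ℕ)
    (h1 : ∀ i, 1 < n i)
    (hdvd : ∀ i j : Fin r, i ≤ j → n i ∣ n j)
    (A : Set (∀ i : Fin r, ZMod (n i)))
    (hA : AddSubgroup.closure A = ⊤)
    (g : ∀ i : Fin r, ZMod (n i)) :
    ∃ (k : ℕ) (f : Fin k → (∀ i : Fin r, ZMod (n i))),
      k ≤ ∑ i, (n i - 1) ∧ (∀ j, f j ∈ A) ∧ ∑ j, f j = g := by
  have hne (i : Fin r) : n i • (Pi.single i 1 : ∀ i : Fin r, ZMod (n i)) = 0 := by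
    rw [← Pi.single_smul]
    simp
  have he : AddSubgroup.closure
      (Set.range fun i => (Pi.single i 1 : ∀ i : Fin r, ZMod (n i))) = ⊤ := by
    rw [eq_top_iff]
    intro x _
    rw [← Finset.univ_sum_single x]
    refine sum_mem fun i _ => ?_
    have hx : (Pi.single i (x i) : ∀ i : Fin r, ZMod (n i)) =
        ((x i).cast : ℤ) • (Pi.single i 1 : ∀ i : Fin r, ZMod (n i)) := by
      rw [← Pi.single_smul]
      simp
    rw [hx]
    exact zsmul_mem (AddSubgroup.subset_closure (Set.mem_range_self i)) _
  obtain ⟨s, hsA, hscard, hs⟩ := exists_multiset_sum_eq_of_nsmul_eq_zero n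
    (fun i => zero_lt_one.trans (h1 i)) hdvd _ hne he A hA g
  induction s using Quotient.inductionOn with
  | h l =>
  refine ⟨l.length, l.get, by simpa using hscard, fun j => hsA _ (by simp), ?_⟩
  simpa [Fin.sum_univ_getElem] using hs
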